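/- arXiv:2012.12667 — 3 statements merged into one kernel-verified Lean document; each statement's English description precedes it below -/
import Mathlib

section
/- For every Schwartz function u on R^N (N ≥ 1), the inequality (∫_{R^N} |Δu|^2 dx)(∫_{R^N} |x|^2 |∇u|^2 dx) ≥ ((N+2)^2/4) (∫_{R^N} |∇u|^2 dx)^2 holds. -/
open MeasureTheory

/-- `i`-th partial derivative of a complex-valued function on `ℝ^N`. -/
noncomputable def pd {N : ℕ} (u : EuclideanSpace ℝ (Fin N) → ℂ) (i : Fin N) :
    EuclideanSpace ℝ (Fin N) → ℂ :=
  fun x => fderiv ℝ u x (EuclideanSpace.single i 1)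

/-- Laplacian of a complex-valued function on `ℝ^N`. -/
noncomputable def lap {N : ℕ} (u : EuclideanSpace ℝ (Fin N) → ℂ) :
    EuclideanSpace ℝ (Fin N) → ℂ :=
  fun x => ∑ i, pd (pd u i) i x

/-- Squared Euclidean norm of the gradient of `u`. -/
noncomputable def gradNormSq {N : ℕ} (u : EuclideanSpace ℝ (Fin N) → ℂ) :
    EuclideanSpace ℝ (Fin N) → ℝ :=
  fun x => ∑ i, ‖pd u i x‖ ^ 2

namespace HUP

open SchwartzMap LineDeriv
open scoped SchwartzMap LineDeriv

/-- Partial derivative as a linear operator on Schwartz functions. -/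
noncomputable def D {N : ℕ} (i : Fin N) :
    𝓢(EuclideanSpace ℝ (Fin N), ℂ) →ₗ[ℝ] 𝓢(EuclideanSpace ℝ (Fin N), ℂ) :=
  (lineDerivOpCLM ℝ 𝓢(EuclideanSpace ℝ (Fin N), ℂ)
    (EuclideanSpace.single i (1 : ℝ))).toLinearMap

/-- Multiplication by a coordinate. -/
noncomputable def X {N : ℕ} (i : Fin N) :
    𝓢(EuclideanSpace ℝ (Fin N), ℂ) →ₗ[ℝ] 𝓢(EuclideanSpace ℝ (Fin N), ℂ) :=
  (smulLeftCLM ℂ (fun x : EuclideanSpace ℝ (Fin N) => (EuclideanSpace.proj i :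
    EuclideanSpace ℝ (Fin N) →L[ℝ] ℝ) x)).toLinearMap

/-- The real `L²` pairing. -/
noncomputable def B {N : ℕ} (f g : 𝓢(EuclideanSpace ℝ (Fin N), ℂ)) : ℝ :=
  ∫ x, inner ℝ (f x) (g x)

variable {N : ℕ}

lemma D_apply (i : Fin N) (f : 𝓢(EuclideanSpace ℝ (Fin N), ℂ)) (x) :
    D i f x = fderiv ℝ f x (EuclideanSpace.single i 1) := rfl

lemma D_apply' (i : Fin N) (f : 𝓢(EuclideanSpace ℝ (Fin N), ℂ)) :
    (D i f : EuclideanSpace ℝ (Fin N) → ℂ) = pd f i := rfl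

lemma X_apply (i : Fin N) (f : 𝓢(EuclideanSpace ℝ (Fin N), ℂ)) (x) :
    X i f x = x i • f x := by
  have h : Function.HasTemperateGrowth (fun x : EuclideanSpace ℝ (Fin N) =>
      (EuclideanSpace.proj i : EuclideanSpace ℝ (Fin N) →L[ℝ] ℝ) x) := by fun_prop
  have := smulLeftCLM_apply_apply h f x
  simpa [X] using this

lemma integrable_inner (f g : 𝓢(EuclideanSpace ℝ (Fin N), ℂ)) :
    Integrable (fun x => inner ℝ (f x) (g x)) :=
  (pairing (innerSL ℝ) f g).integrable

lemma B_add_left (f g h : 𝓢(EuclideanSpace ℝ (Fin N), ℂ)) : B (f + g) h = B f h + B g h := by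
  unfold B
  rw [← integral_add (integrable_inner _ _) (integrable_inner _ _)]
  simp [inner_add_left]

lemma B_smul_left (c : ℝ) (f h : 𝓢(EuclideanSpace ℝ (Fin N), ℂ)) : B (c • f) h = c * B f h := by
  unfold B
  rw [← integral_const_mul]
  congr 1; ext x
  rw [← real_inner_smul_left]; rfl

lemma B_comm (f g : 𝓢(EuclideanSpace ℝ (Fin N), ℂ)) : B f g = B g f := by
  unfold B; simp_rw [real_inner_comm]

lemma B_add_right (f g h : 𝓢(EuclideanSpace ℝ (Fin N), ℂ)) : B h (f + g) = B h f + B h g := by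
  rw [B_comm, B_add_left, B_comm f, B_comm g]

lemma B_smul_right (c : ℝ) (f h : 𝓢(EuclideanSpace ℝ (Fin N), ℂ)) : B h (c • f) = c * B h f := by
  rw [B_comm, B_smul_left, B_comm]

lemma B_sum_left {ι : Type*} (s : Finset ι) (f : ι → 𝓢(EuclideanSpace ℝ (Fin N), ℂ)) (h) :
    B (∑ i ∈ s, f i) h = ∑ i ∈ s, B (f i) h := by
  let φ : 𝓢(EuclideanSpace ℝ (Fin N), ℂ) →+ ℝ := AddMonoidHom.mk' (fun f => B f h)
    (fun f g => B_add_left f g h)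
  exact map_sum φ f s

lemma B_sum_right {ι : Type*} (s : Finset ι) (f : ι → 𝓢(EuclideanSpace ℝ (Fin N), ℂ)) (h) :
    B h (∑ i ∈ s, f i) = ∑ i ∈ s, B h (f i) := by
  rw [B_comm, B_sum_left]; simp_rw [B_comm h]

lemma B_D (i : Fin N) (f g : 𝓢(EuclideanSpace ℝ (Fin N), ℂ)) : B (D i f) g = - B f (D i g) := by
  have := integral_bilinear_lineDerivOp_right_eq_neg_left (μ := volume) f g (innerSL ℝ)
    (EuclideanSpace.single i (1 : ℝ))
  have h2 : B f (D i g) = - B (D i f) g := this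
  linarith

lemma B_X (i : Fin N) (f g : 𝓢(EuclideanSpace ℝ (Fin N), ℂ)) : B (X i f) g = B f (X i g) := by
  unfold B
  simp_rw [X_apply, real_inner_smul_left, real_inner_smul_right]

lemma B_self_nonneg (f : 𝓢(EuclideanSpace ℝ (Fin N), ℂ)) : 0 ≤ B f f :=
  integral_nonneg fun _ => real_inner_self_nonneg

lemma D_X (i j : Fin N) (f : 𝓢(EuclideanSpace ℝ (Fin N), ℂ)) :
    D i (X j f) = X j (D i f) + if i = j then f else 0 := by
  ext x
  have e : (X j f : EuclideanSpace ℝ (Fin N) → ℂ) = fun x => (EuclideanSpace.proj j :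
      EuclideanSpace ℝ (Fin N) →L[ℝ] ℝ) x • f x := by
    ext x; rw [X_apply]; rfl
  have h1 := (ContinuousLinearMap.hasFDerivAt (EuclideanSpace.proj j :
      EuclideanSpace ℝ (Fin N) →L[ℝ] ℝ) (x := x)).smul (f.hasFDerivAt x)
  have h2 : fderiv ℝ (fun x => (EuclideanSpace.proj j :
      EuclideanSpace ℝ (Fin N) →L[ℝ] ℝ) x • f x) x = _ := HasFDerivAt.fderiv h1
  rw [D_apply, e, h2]
  rw [add_apply, add_apply, X_apply, D_apply]
  by_cases hij : i = j
  · subst hij; simp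
  · simp [hij, Ne.symm hij]

lemma D_comm (i j : Fin N) (f : 𝓢(EuclideanSpace ℝ (Fin N), ℂ)) :
    D i (D j f) = D j (D i f) := by
  ext x
  have hs : IsSymmSndFDerivAt ℝ f x := by
    apply ContDiffAt.isSymmSndFDerivAt (n := 2) (f.smooth 2).contDiffAt
    simp
  have key : ∀ a b : Fin N, D a (D b f) x =
      fderiv ℝ (fderiv ℝ f) x (EuclideanSpace.single a 1) (EuclideanSpace.single b 1) := by
    intro a b
    have hd : HasFDerivAt (fderiv ℝ f) (fderiv ℝ (fderiv ℝ f) x) x :=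
      (fderivCLM ℝ _ ℂ f).hasFDerivAt x
    have h2 := hd.clm_apply (hasFDerivAt_const (EuclideanSpace.single b (1:ℝ)) x)
    rw [D_apply]
    have e : (D b f : EuclideanSpace ℝ (Fin N) → ℂ) =
      fun y => fderiv ℝ f y (EuclideanSpace.single b 1) := rfl
    rw [e, h2.fderiv]
    simp
  rw [key, key]
  exact hs _ _

/-- Euler operator. -/
noncomputable def E (f : 𝓢(EuclideanSpace ℝ (Fin N), ℂ)) : 𝓢(EuclideanSpace ℝ (Fin N), ℂ) :=
  ∑ i, X i (D i f)

lemma B_E (f : 𝓢(EuclideanSpace ℝ (Fin N), ℂ)) : B (E f) f = - (N / 2 : ℝ) * B f f := by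
  have h : B (E f) f = - B f (E f) - N * B f f := by
    unfold E
    simp_rw [B_sum_left, B_sum_right, B_X, B_D, D_X, B_add_right]
    simp [Finset.sum_add_distrib]
    ring
  rw [B_comm f] at h
  linarith

lemma D_E (i : Fin N) (f : 𝓢(EuclideanSpace ℝ (Fin N), ℂ)) : D i (E f) = E (D i f) + D i f := by
  unfold E
  simp_rw [map_sum, D_X, Finset.sum_add_distrib, D_comm i]
  simp

/-- Laplacian. -/
noncomputable def L (f : 𝓢(EuclideanSpace ℝ (Fin N), ℂ)) : 𝓢(EuclideanSpace ℝ (Fin N), ℂ) :=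
  ∑ i, D i (D i f)

/-- Dirichlet energy. -/
noncomputable def G (f : 𝓢(EuclideanSpace ℝ (Fin N), ℂ)) : ℝ :=
  ∑ i, B (D i f) (D i f)

lemma B_L (f : 𝓢(EuclideanSpace ℝ (Fin N), ℂ)) :
    B (L f) (E f + (N : ℝ) • f) = - ((N + 2) / 2 : ℝ) * G f := by
  unfold L G
  rw [B_sum_left, Finset.mul_sum]
  refine Finset.sum_congr rfl fun i _ => ?_
  rw [B_D, map_add, map_smul, D_E, B_add_right, B_add_right, B_smul_right, B_comm _ (E _), B_E]
  ring

lemma B_W (f : 𝓢(EuclideanSpace ℝ (Fin N), ℂ)) :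
    B (E f + (N : ℝ) • f) (E f + (N : ℝ) • f) = B (E f) (E f) := by
  simp only [B_add_right, B_add_left, B_smul_left, B_smul_right]
  rw [B_comm f (E f), B_E]
  ring

lemma abstract_ineq (f : 𝓢(EuclideanSpace ℝ (Fin N), ℂ)) :
    ((N : ℝ) + 2) ^ 2 / 4 * G f ^ 2 ≤ B (L f) (L f) * B (E f) (E f) := by
  have h : ∀ t : ℝ, 0 ≤ B (E f) (E f) * (t * t) + (-(N + 2) * G f) * t + B (L f) (L f) := by
    intro t
    have h0 := B_self_nonneg (L f + t • (E f + (N : ℝ) • f))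
    rw [B_add_left, B_add_right, B_add_right, B_smul_left, B_smul_left, B_smul_right,
      B_smul_right, B_W, B_comm (E f + (N : ℝ) • f) (L f), B_L] at h0
    linarith
  have := discrim_le_zero h
  unfold discrim at this
  nlinarith

lemma int_normSq (f : 𝓢(EuclideanSpace ℝ (Fin N), ℂ)) : B f f = ∫ x, ‖f x‖ ^ 2 := by
  unfold B; simp_rw [real_inner_self_eq_norm_sq]

lemma integrable_normSq (f : 𝓢(EuclideanSpace ℝ (Fin N), ℂ)) :
    Integrable (fun x => ‖f x‖ ^ 2) := by
  have := integrable_inner f f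
  simp_rw [real_inner_self_eq_norm_sq] at this
  exact this

lemma E_le (f : 𝓢(EuclideanSpace ℝ (Fin N), ℂ)) :
    B (E f) (E f) ≤ ∫ x, ‖x‖ ^ 2 * gradNormSq (fun y => f y) x := by
  rw [int_normSq]
  have hpt : ∀ x : EuclideanSpace ℝ (Fin N), ‖x‖ ^ 2 * gradNormSq (fun y => f y) x =
      ∑ i, ∑ j, ‖X i (D j f) x‖ ^ 2 := by
    intro x
    rw [EuclideanSpace.norm_sq_eq, gradNormSq, Finset.sum_mul_sum]
    simp_rw [X_apply, norm_smul, mul_pow]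
    rfl
  refine integral_mono (integrable_normSq _) ?_ fun x => ?_
  · simp_rw [hpt]
    exact integrable_finsetSum _ fun i _ => integrable_finsetSum _ fun j _ => integrable_normSq _
  · have h1 : ‖E f x‖ ≤ ∑ i, ‖x i‖ * ‖D i f x‖ := by
      unfold E
      rw [SchwartzMap.sum_apply]
      refine (norm_sum_le _ _).trans (le_of_eq ?_)
      simp_rw [X_apply, norm_smul]
    calc ‖E f x‖ ^ 2 ≤ (∑ i, ‖x i‖ * ‖D i f x‖) ^ 2 := by gcongr
      _ ≤ (∑ i, ‖x i‖ ^ 2) * ∑ i, ‖D i f x‖ ^ 2 := Finset.sum_mul_sq_le_sq_mul_sq _ _ _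
      _ = _ := by rw [EuclideanSpace.norm_sq_eq]; rfl

lemma G_eq (f : 𝓢(EuclideanSpace ℝ (Fin N), ℂ)) : G f = ∫ x, gradNormSq (fun y => f y) x := by
  unfold G gradNormSq
  rw [integral_finsetSum]
  · simp_rw [int_normSq]; rfl
  · intro i _; exact integrable_normSq (D i f)

lemma L_eq (f : 𝓢(EuclideanSpace ℝ (Fin N), ℂ)) :
    B (L f) (L f) = ∫ x, ‖lap (fun y => f y) x‖ ^ 2 := by
  rw [int_normSq]
  congr 1; ext x
  unfold L lap
  rw [SchwartzMap.sum_apply]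
  rfl

end HUP

theorem second_order_HUP_schwartz {N : ℕ} (hN : 1 ≤ N)
    (u : SchwartzMap (EuclideanSpace ℝ (Fin N)) ℂ) :
    (∫ x, ‖lap (fun y => u y) x‖ ^ 2) * (∫ x, ‖x‖ ^ 2 * gradNormSq (fun y => u y) x) ≥
      ((N : ℝ) + 2) ^ 2 / 4 * (∫ x, gradNormSq (fun y => u y) x) ^ 2 := by
  rw [← HUP.L_eq, ← HUP.G_eq]
  exact (HUP.abstract_ineq u).trans
    (mul_le_mul_of_nonneg_left (HUP.E_le u) (HUP.B_self_nonneg _))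
end

section
/- For any u ∈ C_c^∞(R; C) and any real x, ∫_R |u''(r) + x r u'(r) + x u(r)|^2 dr = (∫_R r^2 |u'(r)|^2 dr) x^2 − 3 (∫_R |u'(r)|^2 dr) x + ∫_R |u''(r)|^2 dr. -/
open MeasureTheory

theorem quadratic_identity_dim_one (u : ℝ → ℂ)
    (hu : ContDiff ℝ (⊤ : ℕ∞) u) (hsupp : HasCompactSupport u) (x : ℝ) :
    ∫ r, ‖deriv (deriv u) r + (x : ℂ) * (r : ℂ) * deriv u r + (x : ℂ) * u r‖ ^ 2 =
      (∫ r, r ^ 2 * ‖deriv u r‖ ^ 2) * x ^ 2 - 3 * (∫ r, ‖deriv u r‖ ^ 2) * x +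
        ∫ r, ‖deriv (deriv u) r‖ ^ 2 := by
  have hu1 : ContDiff ℝ (⊤ : ℕ∞) (deriv u) := (contDiff_infty_iff_deriv.1 hu).2
  have hu2 : ContDiff ℝ (⊤ : ℕ∞) (deriv (deriv u)) := (contDiff_infty_iff_deriv.1 hu1).2
  have c0 := hu.continuous
  have c1 := hu1.continuous
  have c2 := hu2.continuous
  have d0 : ∀ r, HasDerivAt u (deriv u r) r := fun r =>
    ((contDiff_infty_iff_deriv.1 hu).1 r).hasDerivAt
  have d1 : ∀ r, HasDerivAt (deriv u) (deriv (deriv u) r) r := fun r =>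
    ((contDiff_infty_iff_deriv.1 hu1).1 r).hasDerivAt
  have z0 : ∀ r, r ∉ tsupport u → u r = 0 := fun r hr => image_eq_zero_of_notMem_tsupport hr
  have z1 : ∀ r, r ∉ tsupport u → deriv u r = 0 := fun r hr =>
    image_eq_zero_of_notMem_tsupport (fun h => hr (tsupport_deriv_subset h))
  have z2 : ∀ r, r ∉ tsupport u → deriv (deriv u) r = 0 := fun r hr =>
    image_eq_zero_of_notMem_tsupport
      (fun h => hr (tsupport_deriv_subset (tsupport_deriv_subset h)))
  have key : ∀ f : ℝ → ℝ, Continuous f → (∀ r, r ∉ tsupport u → f r = 0) → Integrable f :=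
    fun f hf hz => hf.integrable_of_hasCompactSupport
      (HasCompactSupport.intro hsupp (fun r hr => hz r hr))
  have iA : Integrable (fun r : ℝ => r ^ 2 * ‖deriv u r‖ ^ 2) :=
    key _ (by fun_prop) (fun r hr => by simp [z1 r hr])
  have iB : Integrable (fun r : ℝ => ‖deriv u r‖ ^ 2) :=
    key _ (by fun_prop) (fun r hr => by simp [z1 r hr])
  have iC : Integrable (fun r : ℝ => ‖deriv (deriv u) r‖ ^ 2) :=
    key _ (by fun_prop) (fun r hr => by simp [z2 r hr])
  have iL : Integrable (fun r : ℝ =>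
      ‖deriv (deriv u) r + (x : ℂ) * (r : ℂ) * deriv u r + (x : ℂ) * u r‖ ^ 2) :=
    key _ (by fun_prop) (fun r hr => by simp [z0 r hr, z1 r hr, z2 r hr])
  have iR : Integrable (fun r : ℝ => r ^ 2 * ‖deriv u r‖ ^ 2 * x ^ 2
      - 3 * ‖deriv u r‖ ^ 2 * x + ‖deriv (deriv u) r‖ ^ 2) :=
    ((iA.mul_const _).sub ((iB.const_mul 3).mul_const x)).add iC
  have re_d : ∀ (f : ℝ → ℂ) (f' : ℂ) (r : ℝ), HasDerivAt f f' r →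
      HasDerivAt (fun r => (f r).re) f'.re r := fun f f' r h =>
    Complex.reCLM.hasFDerivAt.comp_hasDerivAt r h
  have im_d : ∀ (f : ℝ → ℂ) (f' : ℂ) (r : ℝ), HasDerivAt f f' r →
      HasDerivAt (fun r => (f r).im) f'.im r := fun f f' r h =>
    Complex.imCLM.hasFDerivAt.comp_hasDerivAt r h
  have zero := integral_eq_zero_of_hasDerivAt_of_integrable
    (f := fun r : ℝ => x ^ 2 * (r * ((u r).re * (u r).re + (u r).im * (u r).im))
      + x * (r * ((deriv u r).re * (deriv u r).re + (deriv u r).im * (deriv u r).im))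
      + 2 * x * ((deriv u r).re * (u r).re + (deriv u r).im * (u r).im))
    (f' := fun r : ℝ =>
      ‖deriv (deriv u) r + (x : ℂ) * (r : ℂ) * deriv u r + (x : ℂ) * u r‖ ^ 2
      - (r ^ 2 * ‖deriv u r‖ ^ 2 * x ^ 2
      - 3 * ‖deriv u r‖ ^ 2 * x + ‖deriv (deriv u) r‖ ^ 2))
    (fun r => by
      have a0 := re_d _ _ r (d0 r)
      have b0 := im_d _ _ r (d0 r)
      have a1 := re_d _ _ r (d1 r)
      have b1 := im_d _ _ r (d1 r)
      have h := ((((hasDerivAt_id' r).fun_mul ((a0.fun_mul a0).fun_add (b0.fun_mul b0))).const_mul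
          (x ^ 2)).fun_add
        (((hasDerivAt_id' r).fun_mul ((a1.fun_mul a1).fun_add (b1.fun_mul b1))).const_mul x)).fun_add
        (((a1.fun_mul a0).fun_add (b1.fun_mul b0)).const_mul (2 * x))
      refine h.congr_deriv ?_
      simp only [Complex.sq_norm, Complex.normSq_apply, Complex.add_re, Complex.add_im,
        Complex.mul_re, Complex.mul_im, Complex.ofReal_re, Complex.ofReal_im]
      ring)
    (iL.sub iR)
    (key _ (by fun_prop) (fun r hr => by simp [z0 r hr, z1 r hr]))
  rw [integral_sub iL iR, sub_eq_zero] at zero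
  have iD : Integrable (fun r : ℝ => r ^ 2 * ‖deriv u r‖ ^ 2 * x ^ 2
      - 3 * ‖deriv u r‖ ^ 2 * x) :=
    (iA.mul_const _).sub ((iB.const_mul 3).mul_const x)
  rw [zero, integral_add iD iC,
    integral_sub (iA.mul_const _) ((iB.const_mul 3).mul_const x), integral_mul_const,
    integral_mul_const, integral_const_mul]
end

section
/- For every smooth compactly supported gradient vector field U = ∇u on R^N (u ∈ C_c^∞(R^N; C), N ≥ 1), the inequality (∫_{R^N} |∇U|^2 dx)(∫_{R^N} |x|^2 |U|^2 dx) ≥ ((N+2)^2/4)(∫_{R^N} |U|^2 dx)^2 holds, where |∇U|^2 = Σ_{i,j} |∂_i ∂_j u|^2. -/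
open MeasureTheory

namespace HUPaux

/-- Real partial derivative. -/
noncomputable def D {N : ℕ} (i : Fin N) (f : EuclideanSpace ℝ (Fin N) → ℝ) :
    EuclideanSpace ℝ (Fin N) → ℝ :=
  fun x => fderiv ℝ f x (EuclideanSpace.single i 1)

/-- Smooth functions. -/
def Sm {N : ℕ} (f : EuclideanSpace ℝ (Fin N) → ℝ) : Prop := ContDiff ℝ (⊤ : ℕ∞) f

variable {N : ℕ} {f g : EuclideanSpace ℝ (Fin N) → ℝ}

theorem Sm.D (hf : Sm f) (i : Fin N) : Sm (D i f) := by
  unfold Sm HUPaux.D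
  exact (hf.fderiv_right (m := (⊤ : ℕ∞)) (by simp)).clm_apply contDiff_const

theorem cs_D (hf : HasCompactSupport f) (i : Fin N) : HasCompactSupport (D i f) :=
  hf.fderiv_apply (𝕜 := ℝ) _

theorem Sm.diff (hf : Sm f) : Differentiable ℝ f := ContDiff.differentiable hf (by simp)

theorem Sm.mul (hf : Sm f) (hg : Sm g) : Sm (fun x => f x * g x) := ContDiff.mul hf hg

theorem Sm.coord (i : Fin N) : Sm (fun x : EuclideanSpace ℝ (Fin N) => x i) := by
  unfold Sm
  fun_prop

theorem Sm.const (c : ℝ) : Sm (fun _ : EuclideanSpace ℝ (Fin N) => c) := contDiff_const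

theorem D_mul (hf : Sm f) (hg : Sm g) (i : Fin N) (x) :
    D i (fun x => f x * g x) x = D i f x * g x + f x * D i g x := by
  unfold D
  rw [fderiv_fun_mul (hf.diff x) (hg.diff x)]
  simp
  ring

theorem D_const (c : ℝ) (i : Fin N) (x) : D i (fun _ => c) x = 0 := by
  simp [D]

theorem D_coord (i j : Fin N) (x) :
    D i (fun x : EuclideanSpace ℝ (Fin N) => x j) x = if i = j then 1 else 0 := by
  have : (fun x : EuclideanSpace ℝ (Fin N) => x j) =
    (EuclideanSpace.proj j : EuclideanSpace ℝ (Fin N) →L[ℝ] ℝ) := by ext; simp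
  unfold D
  rw [this, ContinuousLinearMap.fderiv]
  simp [Pi.single_apply, eq_comm]

theorem D_comm (hf : Sm f) (i j : Fin N) : D i (D j f) = D j (D i f) := by
  ext x
  have hd : DifferentiableAt ℝ (fderiv ℝ f) x :=
    (ContDiff.differentiable (hf.fderiv_right (m := (⊤ : ℕ∞)) (by simp)) (by simp)) x
  have key : ∀ a b : EuclideanSpace ℝ (Fin N),
      fderiv ℝ (fun y => fderiv ℝ f y a) x b = fderiv ℝ (fderiv ℝ f) x b a := by
    intro a b
    rw [fderiv_clm_apply hd (differentiableAt_const _)]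
    simp
  have hs : IsSymmSndFDerivAt ℝ f x := by
    apply (ContDiff.contDiffAt hf).isSymmSndFDerivAt
    simp only [minSmoothness_of_isRCLikeNormedField]
    exact WithTop.coe_le_coe.2 (le_top : (2 : ℕ∞) ≤ ⊤)
  unfold D
  rw [key, key]
  exact hs _ _

theorem integ (hf : Sm f) (hc : HasCompactSupport f) : Integrable f :=
  (ContDiff.continuous hf).integrable_of_hasCompactSupport hc

theorem int_D (hf : Sm f) (hc : HasCompactSupport f) (i : Fin N) : ∫ x, D i f x = 0 := by
  have h := integral_mul_fderiv_eq_neg_fderiv_mul_of_integrable (𝕜 := ℝ)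
    (μ := (volume : Measure (EuclideanSpace ℝ (Fin N))))
    (f := fun _ => (1:ℝ)) (g := f) (v := EuclideanSpace.single i 1)
    (by simp) (by simpa [D] using (show Integrable (fun x => D i f x) from integ (hf.D i) (cs_D hc i)))
    (by simpa using integ hf hc) (by fun_prop) (fun x _ => hf.diff x)
  simpa [D] using h

/-- total divergence field -/
theorem quad_real (u : EuclideanSpace ℝ (Fin N) → ℝ) (hu : Sm u) (hc : HasCompactSupport u)
    (t : ℝ) :
    0 ≤ ∫ x, ((∑ i, ∑ j, (D j (D i u) x) ^ 2) - t * (N + 2) * (∑ i, (D i u x) ^ 2)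
      + t ^ 2 * (‖x‖ ^ 2 * ∑ i, (D i u x) ^ 2)) := by
  have s1 := fun i => hu.D i
  have s2 := fun i j => (hu.D i).D j
  have c1 := fun i => cs_D hc i
  have c2 := fun i j => cs_D (cs_D hc i) j
  let F1 : Fin N → Fin N → EuclideanSpace ℝ (Fin N) → ℝ := fun i j x => D i u x * D j (D j u) x
  let F2 : Fin N → Fin N → EuclideanSpace ℝ (Fin N) → ℝ := fun i j x => D i u x * D j (D i u) x
  let F3 : Fin N → EuclideanSpace ℝ (Fin N) → ℝ := fun i x => u x * D i u x
  let F4 : Fin N → Fin N → EuclideanSpace ℝ (Fin N) → ℝ := fun i j x => D i u x * (x j * D j u x)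
  let F5 : Fin N → Fin N → EuclideanSpace ℝ (Fin N) → ℝ := fun i j x => D i u x * (x j * D i u x)
  let F6 : Fin N → EuclideanSpace ℝ (Fin N) → ℝ := fun i x => u x * (x i * u x)
  have f1 : ∀ i j, Sm (F1 i j) := fun i j => (s1 i).mul (s2 j j)
  have f2 : ∀ i j, Sm (F2 i j) := fun i j => (s1 i).mul (s2 i j)
  have f3 : ∀ i, Sm (F3 i) := fun i => hu.mul (s1 i)
  have f4 : ∀ i j, Sm (F4 i j) := fun i j => (s1 i).mul ((Sm.coord j).mul (s1 j))
  have f5 : ∀ i j, Sm (F5 i j) := fun i j => (s1 i).mul ((Sm.coord j).mul (s1 i))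
  have f6 : ∀ i, Sm (F6 i) := fun i => hu.mul ((Sm.coord i).mul hu)
  have g1 : ∀ i j, HasCompactSupport (F1 i j) := fun i j => (c1 i).mul_right
  have g2 : ∀ i j, HasCompactSupport (F2 i j) := fun i j => (c1 i).mul_right
  have g3 : ∀ i, HasCompactSupport (F3 i) := fun i => hc.mul_right
  have g4 : ∀ i j, HasCompactSupport (F4 i j) := fun i j => (c1 i).mul_right
  have g5 : ∀ i j, HasCompactSupport (F5 i j) := fun i j => (c1 i).mul_right
  have g6 : ∀ i, HasCompactSupport (F6 i) := fun i => hc.mul_right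
  let R : EuclideanSpace ℝ (Fin N) → ℝ := fun x =>
    (∑ i, ∑ j, (D i (F1 i j) x - D j (F2 i j) x)) + (∑ i, (2 * N * t) * D i (F3 i) x)
    + (∑ i, ∑ j, ((2 * t) * D i (F4 i j) x - t * D j (F5 i j) x))
    + ∑ i, (N * t ^ 2) * D i (F6 i) x
  have i1 := fun i j k => integ ((f1 i j).D k) (cs_D (g1 i j) k)
  have i2 := fun i j k => integ ((f2 i j).D k) (cs_D (g2 i j) k)
  have i3 := fun i k => integ ((f3 i).D k) (cs_D (g3 i) k)
  have i4 := fun i j k => integ ((f4 i j).D k) (cs_D (g4 i j) k)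
  have i5 := fun i j k => integ ((f5 i j).D k) (cs_D (g5 i j) k)
  have i6 := fun i k => integ ((f6 i).D k) (cs_D (g6 i) k)
  have p1 : ∀ i j, Integrable fun x => D i (F1 i j) x - D j (F2 i j) x :=
    fun i j => (i1 i j i).sub (i2 i j j)
  have p3 : ∀ i j, Integrable fun x => (2 * t) * D i (F4 i j) x - t * D j (F5 i j) x :=
    fun i j => ((i4 i j i).const_mul _).sub ((i5 i j j).const_mul _)
  have a1 : Integrable fun x => ∑ i, ∑ j, (D i (F1 i j) x - D j (F2 i j) x) :=
    integrable_finsetSum _ fun i _ => integrable_finsetSum _ fun j _ => p1 i j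
  have a2 : Integrable fun x => ∑ i, (2 * N * t) * D i (F3 i) x :=
    integrable_finsetSum _ fun i _ => (i3 i i).const_mul _
  have a3 : Integrable fun x => ∑ i, ∑ j, ((2 * t) * D i (F4 i j) x - t * D j (F5 i j) x) :=
    integrable_finsetSum _ fun i _ => integrable_finsetSum _ fun j _ => p3 i j
  have a4 : Integrable fun x => ∑ i, (N * t ^ 2) * D i (F6 i) x :=
    integrable_finsetSum _ fun i _ => (i6 i i).const_mul _
  have b1 : ∫ x, ∑ i, ∑ j, (D i (F1 i j) x - D j (F2 i j) x) = 0 := by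
    rw [integral_finsetSum _ fun i _ => integrable_finsetSum _ fun j _ => p1 i j]
    refine Finset.sum_eq_zero fun i _ => ?_
    rw [integral_finsetSum _ fun j _ => p1 i j]
    refine Finset.sum_eq_zero fun j _ => ?_
    rw [integral_sub (i1 i j i) (i2 i j j), int_D (f1 i j) (g1 i j), int_D (f2 i j) (g2 i j)]
    simp
  have b2 : ∫ x, ∑ i, (2 * N * t) * D i (F3 i) x = 0 := by
    rw [integral_finsetSum _ fun i _ => (i3 i i).const_mul _]
    refine Finset.sum_eq_zero fun i _ => ?_
    rw [integral_const_mul, int_D (f3 i) (g3 i)]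
    simp
  have b3 : ∫ x, ∑ i, ∑ j, ((2 * t) * D i (F4 i j) x - t * D j (F5 i j) x) = 0 := by
    rw [integral_finsetSum _ fun i _ => integrable_finsetSum _ fun j _ => p3 i j]
    refine Finset.sum_eq_zero fun i _ => ?_
    rw [integral_finsetSum _ fun j _ => p3 i j]
    refine Finset.sum_eq_zero fun j _ => ?_
    rw [integral_sub ((i4 i j i).const_mul _) ((i5 i j j).const_mul _), integral_const_mul,
      integral_const_mul, int_D (f4 i j) (g4 i j), int_D (f5 i j) (g5 i j)]
    simp
  have b4 : ∫ x, ∑ i, (N * t ^ 2) * D i (F6 i) x = 0 := by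
    rw [integral_finsetSum _ fun i _ => (i6 i i).const_mul _]
    refine Finset.sum_eq_zero fun i _ => ?_
    rw [integral_const_mul, int_D (f6 i) (g6 i)]
    simp
  have hRi : Integrable R := ((a1.add a2).add a3).add a4
  have hR : ∫ x, R x = 0 := by
    have e1 := integral_add ((a1.add a2).add a3) a4
    have e2 := integral_add (a1.add a2) a3
    have e3 := integral_add a1 a2
    simp only [Pi.add_apply] at e1 e2 e3
    change ∫ x, (_ + _ + _ + _) = 0
    rw [e1, e2, e3, b1, b2, b3, b4]
    simp
  -- pointwise inequality
  have hpt : ∀ x, -R x ≤ ((∑ i, ∑ j, (D j (D i u) x) ^ 2) - t * (N + 2) * (∑ i, (D i u x) ^ 2)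
      + t ^ 2 * (‖x‖ ^ 2 * ∑ i, (D i u x) ^ 2)) := by
    intro x
    have r1 : ∑ i, ∑ j, (D i (F1 i j) x - D j (F2 i j) x) =
        (∑ i, D i (D i u) x) ^ 2 - ∑ i, ∑ j, (D j (D i u) x) ^ 2 := by
      rw [sq, Finset.sum_mul_sum, ← Finset.sum_sub_distrib]
      refine Finset.sum_congr rfl fun i _ => ?_
      rw [← Finset.sum_sub_distrib]
      refine Finset.sum_congr rfl fun j _ => ?_
      simp only [F1, F2]
      rw [D_mul (s1 i) (s2 j j), D_mul (s1 i) (s2 i j), D_comm (s1 j) i j, D_comm hu i j]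
      ring
    have r2 : ∑ i, (2 * N * t) * D i (F3 i) x =
        2 * N * t * (∑ i, (D i u x) ^ 2 + u x * ∑ i, D i (D i u) x) := by
      rw [Finset.mul_sum, ← Finset.sum_add_distrib, Finset.mul_sum]
      refine Finset.sum_congr rfl fun i _ => ?_
      simp only [F3]
      rw [D_mul hu (s1 i)]
      ring
    have r3 : ∑ i, ∑ j, ((2 * t) * D i (F4 i j) x - t * D j (F5 i j) x) =
        2 * t * ((∑ i, D i (D i u) x) * (∑ j, x j * D j u x)) + 2 * t * (∑ i, (D i u x) ^ 2)
        - N * t * (∑ i, (D i u x) ^ 2) := by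
      have : ∀ i j, ((2 * t) * D i (F4 i j) x - t * D j (F5 i j) x) =
          2 * t * (D i (D i u) x * (x j * D j u x))
          + (if i = j then 2 * t * (D i u x * D j u x) else 0) - t * (D i u x) ^ 2 := by
        intro i j
        simp only [F4, F5]
        rw [D_mul (s1 i) ((Sm.coord j).mul (s1 j)), D_mul (s1 i) ((Sm.coord j).mul (s1 i)),
          D_mul (Sm.coord j) (s1 j), D_mul (Sm.coord j) (s1 i), D_coord, D_coord, D_comm hu i j, if_pos (rfl : j = j)]
        split_ifs <;> simp <;> ring
      simp only [this, Finset.sum_sub_distrib, Finset.sum_add_distrib, Finset.sum_mul_sum,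
        ← Finset.mul_sum, Finset.sum_ite_eq, Finset.mem_univ, if_true, Finset.sum_const,
        Finset.card_univ, Fintype.card_fin, nsmul_eq_mul, ← sq]
      simp only [← Finset.mul_sum, ← Finset.sum_mul]
      ring
    have r4 : ∑ i, (N * t ^ 2) * D i (F6 i) x =
        N * t ^ 2 * (2 * u x * (∑ j, x j * D j u x) + N * (u x) ^ 2) := by
      have : ∀ i, (N * t ^ 2) * D i (F6 i) x =
          N * t ^ 2 * (2 * u x * (x i * D i u x)) + N * t ^ 2 * (u x) ^ 2 := by
        intro i
        simp only [F6]
        rw [D_mul hu ((Sm.coord i).mul hu), D_mul (Sm.coord i) hu, D_coord]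
        simp
        ring
      simp only [this, Finset.sum_add_distrib, ← Finset.mul_sum, Finset.sum_const,
        Finset.card_univ, Fintype.card_fin, nsmul_eq_mul]
      ring
    have hcs : (∑ j, x j * D j u x) ^ 2 ≤ ‖x‖ ^ 2 * ∑ i, (D i u x) ^ 2 := by
      rw [EuclideanSpace.real_norm_sq_eq]
      exact Finset.sum_mul_sq_le_sq_mul_sq _ _ _
    simp only [R]
    rw [r1, r2, r3, r4]
    nlinarith [sq_nonneg ((∑ i, D i (D i u) x) + t * (N * u x + ∑ j, x j * D j u x)),
      mul_le_mul_of_nonneg_left hcs (sq_nonneg t)]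
  have hsm : Sm fun x => ((∑ i, ∑ j, (D j (D i u) x) ^ 2) - t * (N + 2) * (∑ i, (D i u x) ^ 2)
      + t ^ 2 * (‖x‖ ^ 2 * ∑ i, (D i u x) ^ 2)) := by
    unfold Sm at *
    have : ContDiff ℝ (⊤ : ℕ∞) fun x : EuclideanSpace ℝ (Fin N) => ‖x‖ ^ 2 := contDiff_norm_sq ℝ
    fun_prop
  have hcs : HasCompactSupport fun x =>
      ((∑ i, ∑ j, (D j (D i u) x) ^ 2) - t * (N + 2) * (∑ i, (D i u x) ^ 2)
      + t ^ 2 * (‖x‖ ^ 2 * ∑ i, (D i u x) ^ 2)) := by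
    refine HasCompactSupport.intro hc fun x hx => ?_
    have z1 : ∀ i, D i u x = 0 := fun i =>
      image_eq_zero_of_notMem_tsupport fun h => hx (tsupport_fderiv_apply_subset ℝ _ h)
    have z2 : ∀ i j, D j (D i u) x = 0 := fun i j =>
      image_eq_zero_of_notMem_tsupport fun h => hx
        (tsupport_fderiv_apply_subset ℝ _ (tsupport_fderiv_apply_subset ℝ _ h))
    simp [z1, z2]
  have := integral_mono hRi.neg (integ hsm hcs) hpt
  simp only [Pi.neg_apply, integral_neg, hR, neg_zero] at this
  exact this

end HUPaux

open HUPaux in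
theorem HUP_gradient_fields {N : ℕ} (hN : 1 ≤ N)
    (u : EuclideanSpace ℝ (Fin N) → ℂ) (hu : ContDiff ℝ (⊤ : ℕ∞) u)
    (hsupp : HasCompactSupport u) :
    (∫ x, ∑ i, ∑ j, ‖pd (pd u i) j x‖ ^ 2) *
      (∫ x, ‖x‖ ^ 2 * ∑ i, ‖pd u i x‖ ^ 2) ≥
      ((N : ℝ) + 2) ^ 2 / 4 * (∫ x, ∑ i, ‖pd u i x‖ ^ 2) ^ 2 := by
  let a : EuclideanSpace ℝ (Fin N) → ℝ := fun x => (u x).re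
  let b : EuclideanSpace ℝ (Fin N) → ℝ := fun x => (u x).im
  have ha : Sm a := Complex.reCLM.contDiff.comp hu
  have hb : Sm b := Complex.imCLM.contDiff.comp hu
  have hca : HasCompactSupport a := hsupp.comp_left (g := Complex.re) rfl
  have hcb : HasCompactSupport b := hsupp.comp_left (g := Complex.im) rfl
  have hre : ∀ (v : EuclideanSpace ℝ (Fin N) → ℂ), Differentiable ℝ v → ∀ i x,
      (pd v i x).re = D i (fun y => (v y).re) x := by
    intro v hv i x
    have := (Complex.reCLM.hasFDerivAt.comp x (hv x).hasFDerivAt).fderiv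
    simp only [D, pd]
    change _ = fderiv ℝ (Complex.reCLM ∘ v) x _
    rw [this]; simp
  have him : ∀ (v : EuclideanSpace ℝ (Fin N) → ℂ), Differentiable ℝ v → ∀ i x,
      (pd v i x).im = D i (fun y => (v y).im) x := by
    intro v hv i x
    have := (Complex.imCLM.hasFDerivAt.comp x (hv x).hasFDerivAt).fderiv
    simp only [D, pd]
    change _ = fderiv ℝ (Complex.imCLM ∘ v) x _
    rw [this]; simp
  have hud : Differentiable ℝ u := hu.differentiable (by simp)
  have hpd : ∀ i, ContDiff ℝ (⊤ : ℕ∞) (pd u i) := fun i =>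
    (hu.fderiv_right (m := (⊤ : ℕ∞)) (by simp)).clm_apply contDiff_const
  have hpdd : ∀ i, Differentiable ℝ (pd u i) := fun i => (hpd i).differentiable (by simp)
  have n1 : ∀ i x, ‖pd u i x‖ ^ 2 = (D i a x) ^ 2 + (D i b x) ^ 2 := by
    intro i x
    rw [Complex.sq_norm, Complex.normSq_apply, hre u hud, him u hud]
    ring
  have n2 : ∀ i j x, ‖pd (pd u i) j x‖ ^ 2 = (D j (D i a) x) ^ 2 + (D j (D i b) x) ^ 2 := by
    intro i j x
    rw [Complex.sq_norm, Complex.normSq_apply, hre _ (hpdd i), him _ (hpdd i)]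
    simp only [hre u hud, him u hud]
    change D j (D i a) x * D j (D i a) x + D j (D i b) x * D j (D i b) x = _
    ring
  have q : ∀ v : EuclideanSpace ℝ (Fin N) → ℝ, Sm v → HasCompactSupport v →
      Integrable (fun x => ∑ i, ∑ j, (D j (D i v) x) ^ 2) ∧
      Integrable (fun x => ∑ i, (D i v x) ^ 2) ∧
      Integrable (fun x => ‖x‖ ^ 2 * ∑ i, (D i v x) ^ 2) := by
    intro v hv hc
    have s1 := fun i => hv.D i
    have s2 := fun i j => (hv.D i).D j
    have z1 : ∀ x ∉ tsupport v, ∀ i, D i v x = 0 := fun x hx i =>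
      image_eq_zero_of_notMem_tsupport fun h => hx (tsupport_fderiv_apply_subset ℝ _ h)
    have z2 : ∀ x ∉ tsupport v, ∀ i j, D j (D i v) x = 0 := fun x hx i j =>
      image_eq_zero_of_notMem_tsupport fun h => hx
        (tsupport_fderiv_apply_subset ℝ _ (tsupport_fderiv_apply_subset ℝ _ h))
    have hn : ContDiff ℝ (⊤ : ℕ∞) fun x : EuclideanSpace ℝ (Fin N) => ‖x‖ ^ 2 :=
      contDiff_norm_sq ℝ
    unfold Sm at s1 s2
    refine ⟨integ ?_ (HasCompactSupport.intro hc fun x hx => by simp [z2 x hx]),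
      integ ?_ (HasCompactSupport.intro hc fun x hx => by simp [z1 x hx]),
      integ ?_ (HasCompactSupport.intro hc fun x hx => by simp [z1 x hx])⟩ <;>
    · unfold Sm
      fun_prop
  obtain ⟨qa1, qa2, qa3⟩ := q a ha hca
  obtain ⟨qb1, qb2, qb3⟩ := q b hb hcb
  have split : ∀ v : EuclideanSpace ℝ (Fin N) → ℝ, Sm v → HasCompactSupport v → ∀ t : ℝ,
      0 ≤ (∫ x, ∑ i, ∑ j, (D j (D i v) x) ^ 2) - t * (N + 2) * (∫ x, ∑ i, (D i v x) ^ 2)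
      + t ^ 2 * ∫ x, ‖x‖ ^ 2 * ∑ i, (D i v x) ^ 2 := by
    intro v hv hc t
    obtain ⟨q1, q2, q3⟩ := q v hv hc
    have h := quad_real v hv hc t
    have q12 : Integrable fun x => (∑ i, ∑ j, (D j (D i v) x) ^ 2)
        - t * (N + 2) * (∑ i, (D i v x) ^ 2) := q1.sub (q2.const_mul _)
    rw [integral_add q12 (q3.const_mul _),
      integral_sub q1 (q2.const_mul _), integral_const_mul, integral_const_mul] at h
    exact h
  simp only [n1, n2, Finset.sum_add_distrib, mul_add]
  rw [integral_add qa1 qb1, integral_add qa2 qb2, integral_add qa3 qb3]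
  have hA := split a ha hca
  have hB := split b hb hcb
  generalize (∫ x, ∑ i, ∑ j, (D j (D i a) x) ^ 2) = A1 at *
  generalize (∫ x, ∑ i, ∑ j, (D j (D i b) x) ^ 2) = A2 at *
  generalize (∫ x, ∑ i, (D i a x) ^ 2) = C1 at *
  generalize (∫ x, ∑ i, (D i b x) ^ 2) = C2 at *
  generalize (∫ x, ‖x‖ ^ 2 * ∑ i, (D i a x) ^ 2) = B1 at *
  generalize (∫ x, ‖x‖ ^ 2 * ∑ i, (D i b x) ^ 2) = B2 at *
  have := discrim_le_zero (a := B1 + B2) (b := -((N + 2) * (C1 + C2))) (c := A1 + A2)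
    (fun t => by nlinarith [hA t, hB t])
  unfold discrim at this
  nlinarith
end
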